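/- Let W be an n×n symmetric doubly stochastic matrix (n > 1) with W_{ii} > 0 for all i whose associated graph is connected. Then for every i ∈ [n] and every t ≥ 1, Σ_{τ=1}^{t} Σ_{j=1}^n | [W^{t−τ}]_{ij} − 1/n | ≤ 4 log n / (1 − σ₂(W)). -/

import Mathlib

open MeasureTheory ProbabilityTheory Real Finset

/-- A measurable space structure on real matrices (the product σ-algebra). -/
instance matrixMeasurableSpace {n : ℕ} : MeasurableSpace (Matrix (Fin n) (Fin n) ℝ) :=
  (inferInstance : MeasurableSpace (Fin n → Fin n → ℝ))

/-- Kullback-Leibler divergence between two probability vectors on `Fin m`. -/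
noncomputable def klVec {m : ℕ} (p q : Fin m → ℝ) : ℝ :=
  ∑ k, p k * Real.log (p k / q k)

/-- Kullback-Leibler divergence between two probability densities with respect to a common
reference measure `ν`. -/
noncomputable def klDens {S : Type*} [MeasurableSpace S] (ν : Measure S) (f g : S → ℝ) : ℝ :=
  ∫ x, f x * Real.log (f x / g x) ∂ν

/-- A square matrix is doubly stochastic if its entries are nonnegative and all row and column
sums equal one. -/
def IsDoublyStochastic {n : ℕ} (W : Matrix (Fin n) (Fin n) ℝ) : Prop :=
  (∀ i j, 0 ≤ W i j) ∧ (∀ i, ∑ j, W i j = 1) ∧ (∀ j, ∑ i, W i j = 1)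

/-- The second largest singular value of a symmetric doubly stochastic matrix, realized as the
operator norm of the matrix restricted to the orthogonal complement of the all-ones vector. -/
noncomputable def sigma2 {n : ℕ} (W : Matrix (Fin n) (Fin n) ℝ) : ℝ :=
  sSup {c : ℝ | ∃ x : Fin n → ℝ, (∑ i, x i) = 0 ∧ (∑ i, (x i) ^ 2) = 1 ∧
    c = Real.sqrt (∑ i, (W.mulVec x i) ^ 2)}

/-- The graph associated with a nonnegative matrix: `i ∼ j` iff `W i j > 0`. -/
def assocGraph {n : ℕ} (W : Matrix (Fin n) (Fin n) ℝ) : SimpleGraph (Fin n) :=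
  SimpleGraph.fromRel (fun i j => 0 < W i j)

/-- Backward product `W t * W (t-1) * ⋯ * W (τ+1)` (the identity matrix when `τ ≥ t`). -/
def backProd {n : ℕ} (W : ℕ → Matrix (Fin n) (Fin n) ℝ) : ℕ → ℕ → Matrix (Fin n) (Fin n) ℝ
  | 0, _ => 1
  | t + 1, τ => if t + 1 ≤ τ then 1 else W (t + 1) * backProd W t τ

/-- `I(θ₁, θ_k)`: the average over agents of the KL divergence of the signal density under the
true state (index `0`) from the density under state `k`. -/
noncomputable def Ikl {n m : ℕ} [NeZero m] {S : Fin n → Type*} [∀ j, MeasurableSpace (S j)]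
    (ν : (j : Fin n) → Measure (S j)) (ℓ : (j : Fin n) → Fin m → S j → ℝ) (k : Fin m) : ℝ :=
  (1 / (n : ℝ)) * ∑ j, klDens (ν j) (ℓ j 0) (ℓ j k)

/-- The loss of squared norm under a doubly stochastic matrix, written as a sum of variances. -/
lemma sum_sq_sub_sum_mulVec_sq {n : ℕ} {W : Matrix (Fin n) (Fin n) ℝ}
    (hds : IsDoublyStochastic W) (x : Fin n → ℝ) :
    ∑ j, x j ^ 2 - ∑ i, W.mulVec x i ^ 2 = ∑ i, ∑ j, W i j * (x j - W.mulVec x i) ^ 2 := by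
  have hrow (i : Fin n) : ∑ j, W i j * (x j - W.mulVec x i) ^ 2 =
      ∑ j, W i j * x j ^ 2 - W.mulVec x i ^ 2 := by
    have hmean : ∑ j, W i j * x j = W.mulVec x i := rfl
    calc ∑ j, W i j * (x j - W.mulVec x i) ^ 2
        = ∑ j, W i j * x j ^ 2 - 2 * W.mulVec x i * ∑ j, W i j * x j
            + W.mulVec x i ^ 2 * ∑ j, W i j := by
          rw [Finset.mul_sum, Finset.mul_sum, ← Finset.sum_sub_distrib, ← Finset.sum_add_distrib]
          exact Finset.sum_congr rfl fun j _ => by ring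
      _ = ∑ j, W i j * x j ^ 2 - W.mulVec x i ^ 2 := by rw [hmean, hds.2.1 i]; ring
  have hcol : ∑ i, ∑ j, W i j * x j ^ 2 = ∑ j, x j ^ 2 := by
    rw [Finset.sum_comm]
    exact Finset.sum_congr rfl fun j _ => by rw [← Finset.sum_mul, hds.2.2 j, one_mul]
  simp_rw [hrow]
  rw [Finset.sum_sub_distrib, hcol]

lemma sum_mulVec_sq_le {n : ℕ} {W : Matrix (Fin n) (Fin n) ℝ}
    (hds : IsDoublyStochastic W) (x : Fin n → ℝ) :
    ∑ i, W.mulVec x i ^ 2 ≤ ∑ j, x j ^ 2 := by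
  have h : 0 ≤ ∑ i, ∑ j, W i j * (x j - W.mulVec x i) ^ 2 :=
    Finset.sum_nonneg fun i _ => Finset.sum_nonneg fun j _ => mul_nonneg (hds.1 i j) (sq_nonneg _)
  linarith [sum_sq_sub_sum_mulVec_sq hds x]

/-- If the graph is connected and the diagonal is positive, then only constant vectors keep
their norm. -/
lemma eq_of_sum_mulVec_sq_eq {n : ℕ} {W : Matrix (Fin n) (Fin n) ℝ}
    (hds : IsDoublyStochastic W) (hdiag : ∀ i, 0 < W i i) (hconn : (assocGraph W).Connected)
    {x : Fin n → ℝ} (hx : ∑ i, W.mulVec x i ^ 2 = ∑ j, x j ^ 2) (a b : Fin n) : x a = x b := by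
  have hterm (i j : Fin n) : 0 ≤ W i j * (x j - W.mulVec x i) ^ 2 :=
    mul_nonneg (hds.1 i j) (sq_nonneg _)
  have hzero : ∑ i, ∑ j, W i j * (x j - W.mulVec x i) ^ 2 = 0 := by
    rw [← sum_sq_sub_sum_mulVec_sq hds x, hx, sub_self]
  have hmean {i j : Fin n} (hij : 0 < W i j) : x j = W.mulVec x i := by
    have hi := (Finset.sum_eq_zero_iff_of_nonneg
      fun i _ => Finset.sum_nonneg fun j _ => hterm i j).1 hzero i (Finset.mem_univ i)
    have hj := (Finset.sum_eq_zero_iff_of_nonneg fun j _ => hterm i j).1 hi j (Finset.mem_univ j)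
    rcases mul_eq_zero.1 hj with h | h
    · exact absurd h hij.ne'
    · exact sub_eq_zero.1 (pow_eq_zero_iff two_ne_zero |>.1 h)
  have hpos {i j : Fin n} (hij : 0 < W i j) : x i = x j :=
    (hmean (hdiag i)).trans (hmean hij).symm
  have hadj {i j : Fin n} (hij : (assocGraph W).Adj i j) : x i = x j := by
    rcases ((SimpleGraph.fromRel_adj _ i j).1 hij).2 with h | h
    · exact hpos h
    · exact (hpos h).symm
  obtain ⟨p⟩ := hconn.preconnected a b
  induction p with
  | nil => rfl
  | cons h _ ih => exact (hadj h).trans ih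

lemma sigma2_nonneg {n : ℕ} (W : Matrix (Fin n) (Fin n) ℝ) : 0 ≤ sigma2 W :=
  Real.sSup_nonneg fun _ ⟨_, _, _, hc⟩ => hc ▸ Real.sqrt_nonneg _

lemma isCompact_zero_sum_unit_sphere (n : ℕ) :
    IsCompact {x : Fin n → ℝ | ∑ i, x i = 0 ∧ ∑ i, x i ^ 2 = 1} := by
  refine Metric.isCompact_of_isClosed_isBounded ?_ ?_
  · exact (isClosed_eq (by fun_prop) continuous_const).inter
      (isClosed_eq (by fun_prop) continuous_const)
  · refine (Metric.isBounded_closedBall (x := (0 : Fin n → ℝ)) (r := 1)).subset fun x hx => ?_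
    rw [mem_closedBall_zero_iff, pi_norm_le_iff_of_nonneg zero_le_one]
    intro i
    rw [Real.norm_eq_abs, ← sq_le_one_iff_abs_le_one, ← hx.2]
    exact Finset.single_le_sum (f := fun i => x i ^ 2) (fun j _ => sq_nonneg _) (Finset.mem_univ i)

lemma sigma2_lt_one {n : ℕ} {W : Matrix (Fin n) (Fin n) ℝ}
    (hds : IsDoublyStochastic W) (hdiag : ∀ i, 0 < W i i) (hconn : (assocGraph W).Connected) :
    sigma2 W < 1 := by
  have himage : {c : ℝ | ∃ x : Fin n → ℝ, (∑ i, x i) = 0 ∧ (∑ i, (x i) ^ 2) = 1 ∧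
      c = Real.sqrt (∑ i, (W.mulVec x i) ^ 2)} =
      (fun x : Fin n → ℝ => Real.sqrt (∑ i, (W.mulVec x i) ^ 2)) ''
        {x | ∑ i, x i = 0 ∧ ∑ i, x i ^ 2 = 1} := by
    ext c
    constructor
    · rintro ⟨x, h0, h1, rfl⟩
      exact ⟨x, ⟨h0, h1⟩, rfl⟩
    · rintro ⟨x, ⟨h0, h1⟩, rfl⟩
      exact ⟨x, h0, h1, rfl⟩
  unfold sigma2
  rw [himage]
  rcases Set.eq_empty_or_nonempty {x : Fin n → ℝ | ∑ i, x i = 0 ∧ ∑ i, x i ^ 2 = 1} with he | hne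
  · simp [he]
  have hcont : Continuous fun x : Fin n → ℝ => Real.sqrt (∑ i, (W.mulVec x i) ^ 2) := by
    have (i : Fin n) : Continuous fun x : Fin n → ℝ => W.mulVec x i :=
      (continuous_apply i).comp (continuous_const.matrix_mulVec continuous_id)
    fun_prop
  obtain ⟨x, ⟨h0, h1⟩, hx⟩ :=
    ((isCompact_zero_sum_unit_sphere n).image hcont).sSup_mem (hne.image _)
  rw [← hx]
  refine (Real.sqrt_lt' one_pos).2 ?_
  rw [one_pow, ← h1]
  refine lt_of_le_of_ne (sum_mulVec_sq_le hds x) fun heq => ?_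
  have hzero (a : Fin n) : x a = 0 := by
    have hn : (n : ℝ) ≠ 0 := Nat.cast_ne_zero.2 (Fin.pos a).ne'
    rw [Finset.sum_congr rfl fun b _ => eq_of_sum_mulVec_sq_eq hds hdiag hconn heq b a] at h0
    simpa [hn] using h0
  simp [hzero] at h1

/-- On vectors with zero sum, a doubly stochastic matrix contracts by the factor `sigma2 W`. -/
lemma sum_mulVec_sq_le_sigma2_sq_mul {n : ℕ} {W : Matrix (Fin n) (Fin n) ℝ}
    (hds : IsDoublyStochastic W) {x : Fin n → ℝ} (hx : ∑ i, x i = 0) :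
    ∑ i, W.mulVec x i ^ 2 ≤ sigma2 W ^ 2 * ∑ i, x i ^ 2 := by
  have hnonneg : 0 ≤ ∑ i, x i ^ 2 := Finset.sum_nonneg fun i _ => sq_nonneg _
  rcases hnonneg.eq_or_lt with h | hpos
  · rw [← h, mul_zero, h]
    exact sum_mulVec_sq_le hds x
  set r := Real.sqrt (∑ i, x i ^ 2) with hr
  have hrpos : 0 < r := Real.sqrt_pos.2 hpos
  have hrsq : r ^ 2 = ∑ i, x i ^ 2 := Real.sq_sqrt hnonneg
  have hbdd : BddAbove {c : ℝ | ∃ x : Fin n → ℝ, (∑ i, x i) = 0 ∧ (∑ i, (x i) ^ 2) = 1 ∧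
      c = Real.sqrt (∑ i, (W.mulVec x i) ^ 2)} := by
    refine ⟨1, ?_⟩
    rintro c ⟨y, -, h1, rfl⟩
    exact Real.sqrt_le_one.2 (h1 ▸ sum_mulVec_sq_le hds y)
  have hle : Real.sqrt (∑ i, W.mulVec (r⁻¹ • x) i ^ 2) ≤ sigma2 W := by
    refine le_csSup hbdd ⟨r⁻¹ • x, ?_, ?_, rfl⟩
    · simp [← Finset.mul_sum, hx]
    · simp only [Pi.smul_apply, smul_eq_mul, mul_pow, ← Finset.mul_sum, ← hrsq]
      field_simp
  have hscale : ∑ i, W.mulVec (r⁻¹ • x) i ^ 2 = (r ^ 2)⁻¹ * ∑ i, W.mulVec x i ^ 2 := by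
    simp only [Matrix.mulVec_smul, Pi.smul_apply, smul_eq_mul, mul_pow, ← Finset.mul_sum, inv_pow]
  rw [Real.sqrt_le_left (sigma2_nonneg W), hscale, inv_mul_le_iff₀ (by positivity), hrsq] at hle
  linarith

lemma IsDoublyStochastic.pow {n : ℕ} {W : Matrix (Fin n) (Fin n) ℝ}
    (hds : IsDoublyStochastic W) (k : ℕ) : IsDoublyStochastic (W ^ k) := by
  have hmem : W ∈ doublyStochastic ℝ (Fin n) := mem_doublyStochastic_iff_sum.2 hds
  exact mem_doublyStochastic_iff_sum.1 (pow_mem hmem k)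

lemma sum_pow_sub_inv_sq_le {n : ℕ} (hn : 0 < n) {W : Matrix (Fin n) (Fin n) ℝ}
    (hsym : W.IsSymm) (hds : IsDoublyStochastic W) (i : Fin n) (k : ℕ) :
    ∑ j, ((W ^ k) i j - 1 / (n : ℝ)) ^ 2 ≤ (sigma2 W ^ k) ^ 2 := by
  have hn' : (n : ℝ) ≠ 0 := Nat.cast_ne_zero.2 hn.ne'
  have hsum (k : ℕ) : ∑ j, ((W ^ k) i j - 1 / (n : ℝ)) = 0 := by
    rw [Finset.sum_sub_distrib, (hds.pow k).2.1 i]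
    simp [hn']
  induction k with
  | zero =>
    have hexpand (j : Fin n) : ((W ^ 0) i j - 1 / (n : ℝ)) ^ 2 =
        (if i = j then 1 - 2 / (n : ℝ) else 0) + 1 / (n : ℝ) ^ 2 := by
      rw [pow_zero, Matrix.one_apply]
      split_ifs <;> ring
    simp_rw [hexpand]
    rw [Finset.sum_add_distrib]
    simp only [Finset.sum_ite_eq, Finset.mem_univ, if_true, Finset.sum_const, Finset.card_univ,
      Fintype.card_fin, nsmul_eq_mul, pow_zero, one_pow]
    have hpos : 0 ≤ 1 / (n : ℝ) := by positivity
    have : 1 - 2 / (n : ℝ) + n * (1 / (n : ℝ) ^ 2) = 1 - 1 / (n : ℝ) := by field_simp; ring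
    linarith
  | succ k ih =>
    have hstep (j : Fin n) : (W ^ (k + 1)) i j - 1 / (n : ℝ) =
        W.mulVec (fun l => (W ^ k) i l - 1 / (n : ℝ)) j := by
      simp only [pow_succ, Matrix.mul_apply, Matrix.mulVec, dotProduct, mul_sub,
        Finset.sum_sub_distrib, ← Finset.sum_mul, hds.2.1 j, one_mul]
      congr 1
      exact Finset.sum_congr rfl fun l _ => by rw [hsym.apply l j, mul_comm]
    simp_rw [hstep]
    calc _ ≤ sigma2 W ^ 2 * ∑ j, ((W ^ k) i j - 1 / (n : ℝ)) ^ 2 :=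
          sum_mulVec_sq_le_sigma2_sq_mul hds (hsum k)
      _ ≤ sigma2 W ^ 2 * (sigma2 W ^ k) ^ 2 := by gcongr
      _ = (sigma2 W ^ (k + 1)) ^ 2 := by ring

lemma sum_abs_pow_sub_inv_le {n : ℕ} (hn : 0 < n) {W : Matrix (Fin n) (Fin n) ℝ}
    (hsym : W.IsSymm) (hds : IsDoublyStochastic W) (i : Fin n) (k : ℕ) :
    ∑ j, |(W ^ k) i j - 1 / (n : ℝ)| ≤ Real.sqrt n * sigma2 W ^ k := by
  have hs := sigma2_nonneg W
  refine abs_le_of_sq_le_sq' ?_ (by positivity) |>.2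
  calc (∑ j, |(W ^ k) i j - 1 / (n : ℝ)|) ^ 2
      ≤ n * ∑ j, |(W ^ k) i j - 1 / (n : ℝ)| ^ 2 := by
        simpa using sq_sum_le_card_mul_sum_sq (s := (Finset.univ : Finset (Fin n)))
          (f := fun j => |(W ^ k) i j - 1 / (n : ℝ)|)
    _ ≤ n * (sigma2 W ^ k) ^ 2 := by
        simp_rw [sq_abs]
        gcongr
        exact sum_pow_sub_inv_sq_le hn hsym hds i k
    _ = (Real.sqrt n * sigma2 W ^ k) ^ 2 := by rw [mul_pow, Real.sq_sqrt (Nat.cast_nonneg n)]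

lemma sum_abs_pow_sub_inv_le_two {n : ℕ} (hn : 0 < n) {W : Matrix (Fin n) (Fin n) ℝ}
    (hds : IsDoublyStochastic W) (i : Fin n) (k : ℕ) :
    ∑ j, |(W ^ k) i j - 1 / (n : ℝ)| ≤ 2 := by
  have hn' : (n : ℝ) ≠ 0 := Nat.cast_ne_zero.2 hn.ne'
  calc ∑ j, |(W ^ k) i j - 1 / (n : ℝ)| ≤ ∑ j, ((W ^ k) i j + 1 / (n : ℝ)) := by
        refine Finset.sum_le_sum fun j _ => ?_
        have h := (hds.pow k).1 i j
        have h' : 0 ≤ 1 / (n : ℝ) := by positivity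
        rw [abs_le]
        constructor <;> linarith
    _ = 2 := by
        rw [Finset.sum_add_distrib, (hds.pow k).2.1 i]
        simp only [Finset.sum_const, Finset.card_univ, Fintype.card_fin, nsmul_eq_mul]
        field_simp
        norm_num

lemma sum_range_le_of_geometric {a : ℕ → ℝ} {b s : ℝ} (hb : 0 ≤ b) (hs0 : 0 ≤ s) (hs1 : s < 1)
    (ha : ∀ k, a k ≤ b * s ^ k) (t : ℕ) : ∑ k ∈ Finset.range t, a k ≤ b / (1 - s) := by
  calc ∑ k ∈ Finset.range t, a k ≤ ∑ k ∈ Finset.range t, b * s ^ k :=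
        Finset.sum_le_sum fun k _ => ha k
    _ = b * ∑ k ∈ Finset.range t, s ^ k := by rw [Finset.mul_sum]
    _ ≤ b * (1 - s)⁻¹ := by
        gcongr
        rw [← tsum_geometric_of_lt_one hs0 hs1]
        exact (summable_geometric_of_lt_one hs0 hs1).sum_le_tsum _ fun k _ => pow_nonneg hs0 k
    _ = b / (1 - s) := rfl

/-- A sequence bounded both by a constant and by a geometric sequence: use the constant for the
first `K` terms and the geometric sequence afterwards. -/
lemma sum_range_le_of_bounded_of_geometric {a : ℕ → ℝ} {b c s : ℝ} (hb : 0 ≤ b) (hs0 : 0 ≤ s)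
    (hs1 : s < 1) (ha0 : ∀ k, 0 ≤ a k) (hac : ∀ k, a k ≤ c) (ha : ∀ k, a k ≤ b * s ^ k)
    (t K : ℕ) : ∑ k ∈ Finset.range t, a k ≤ K * c + b * s ^ K / (1 - s) := by
  calc ∑ k ∈ Finset.range t, a k ≤ ∑ k ∈ Finset.range (K + t), a k :=
        Finset.sum_le_sum_of_subset_of_nonneg (Finset.range_mono (Nat.le_add_left t K))
          fun k _ _ => ha0 k
    _ = ∑ k ∈ Finset.range K, a k + ∑ k ∈ Finset.range t, a (K + k) :=
        Finset.sum_range_add a K t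
    _ ≤ K * c + b * s ^ K / (1 - s) := by
        gcongr
        · simpa using Finset.sum_le_card_nsmul (Finset.range K) a c fun k _ => hac k
        · refine sum_range_le_of_geometric (by positivity) hs0 hs1 (fun k => ?_) t
          rw [mul_assoc, ← pow_add]
          exact ha (K + k)

lemma sum_range_le_four_mul_log_div {n : ℕ} (hn : 1 < n) {a : ℕ → ℝ} {s : ℝ} (hs0 : 0 ≤ s)
    (hs1 : s < 1) (ha0 : ∀ k, 0 ≤ a k) (ha2 : ∀ k, a k ≤ 2)
    (ha : ∀ k, a k ≤ Real.sqrt n * s ^ k) (t : ℕ) :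
    ∑ k ∈ Finset.range t, a k ≤ 4 * Real.log n / (1 - s) := by
  have hgap : 0 < 1 - s := sub_pos.2 hs1
  have hnpos : (0 : ℝ) < n := by positivity
  rcases (show 2 ≤ n from hn).eq_or_lt with rfl | h3
  · refine (sum_range_le_of_geometric (Real.sqrt_nonneg _) hs0 hs1 ha t).trans ?_
    gcongr
    have hsqrt : Real.sqrt ((2 : ℕ) : ℝ) ≤ 2 := by
      rw [Real.sqrt_le_left (by norm_num)]
      norm_num
    have hlog := Real.log_two_gt_d9
    push_cast at hsqrt ⊢
    linarith
  have hlog : 1 ≤ Real.log n := by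
    rw [Real.le_log_iff_exp_le hnpos]
    have h3' : (3 : ℝ) ≤ n := by exact_mod_cast h3
    linarith [Real.exp_one_lt_d9]
  set K := ⌈Real.log n / (2 * (1 - s))⌉₊ with hK
  have hK_lower : Real.log n / (2 * (1 - s)) ≤ K := Nat.le_ceil _
  have hK_upper : (K : ℝ) < Real.log n / (2 * (1 - s)) + 1 := Nat.ceil_lt_add_one (by positivity)
  have hdecay : Real.sqrt n * s ^ K ≤ 1 := by
    have hexp : s ^ K ≤ Real.exp (-(Real.log n / 2)) := by
      calc s ^ K ≤ Real.exp (-(1 - s)) ^ K := by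
            gcongr
            linarith [Real.add_one_le_exp (-(1 - s))]
        _ = Real.exp (-(K * (1 - s))) := by rw [← Real.exp_nat_mul]; ring_nf
        _ ≤ Real.exp (-(Real.log n / 2)) := by
            rw [div_le_iff₀ (by positivity)] at hK_lower
            gcongr
            linarith
    have hsqrt : Real.sqrt n = Real.exp (Real.log n / 2) := by
      rw [← Real.log_sqrt hnpos.le, Real.exp_log (Real.sqrt_pos.2 hnpos)]
    calc Real.sqrt n * s ^ K ≤ Real.sqrt n * Real.exp (-(Real.log n / 2)) := by gcongr
      _ = 1 := by rw [hsqrt, ← Real.exp_add, add_neg_cancel, Real.exp_zero]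
  calc ∑ k ∈ Finset.range t, a k ≤ K * 2 + Real.sqrt n * s ^ K / (1 - s) :=
        sum_range_le_of_bounded_of_geometric (Real.sqrt_nonneg _) hs0 hs1 ha0 ha2 ha t K
    _ ≤ (Real.log n / (2 * (1 - s)) + 1) * 2 + 1 / (1 - s) := by gcongr
    _ = (Real.log n + 2 * (1 - s) + 1) / (1 - s) := by field_simp
    _ ≤ 4 * Real.log n / (1 - s) := by
        gcongr
        linarith

/-- mixing bound for a fixed connected, aperiodic doubly stochastic matrix. -/
theorem mixing_sum_bound {n : ℕ} (hn : 1 < n)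
    (W : Matrix (Fin n) (Fin n) ℝ)
    (hsym : W.IsSymm) (hds : IsDoublyStochastic W)
    (hdiag : ∀ i, 0 < W i i) (hconn : (assocGraph W).Connected) :
    ∀ i : Fin n, ∀ t : ℕ, 1 ≤ t →
      ∑ τ ∈ Finset.Icc 1 t, ∑ j, |(W ^ (t - τ)) i j - 1 / (n : ℝ)| ≤
        4 * Real.log n / (1 - sigma2 W) := by
  intro i t _
  have hn' : 0 < n := by omega
  have hreindex : ∑ τ ∈ Finset.Icc 1 t, ∑ j, |(W ^ (t - τ)) i j - 1 / (n : ℝ)| =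
      ∑ k ∈ Finset.range t, ∑ j, |(W ^ k) i j - 1 / (n : ℝ)| := by
    refine Finset.sum_nbij' (fun τ => t - τ) (fun k => t - k) ?_ ?_ ?_ ?_ fun _ _ => rfl <;>
      intro k hk <;> simp only [Finset.mem_Icc, Finset.mem_range] at hk ⊢ <;> omega
  rw [hreindex]
  exact sum_range_le_four_mul_log_div hn (sigma2_nonneg W) (sigma2_lt_one hds hdiag hconn)
    (fun k => Finset.sum_nonneg fun j _ => abs_nonneg _)
    (sum_abs_pow_sub_inv_le_two hn' hds i) (sum_abs_pow_sub_inv_le hn' hsym hds i) t
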